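/- Assume d ≥ 5. In dimension d ≥ 5, γ_d^* > γ_d, where γ_d = lim_n E[Cap(R_n)]/n and γ_d^* = lim_n c_n/n with c_n the maximal capacity of a nearest-neighbor path of length n+1. -/

import Mathlib

open Filter Finset MeasureTheory
open scoped symmDiff ENNReal

namespace SRW

/-- Vertices of `ℤ^d`. -/
abbrev V (d : ℕ) : Type := Fin d → ℤ

/-- The set of nearest-neighbor steps (the `2d` unit vectors `±e_i`) in `ℤ^d`. -/
def steps (d : ℕ) : Finset (V d) :=
  (Finset.univ : Finset (Fin d × Bool)).image
    (fun p j => if j = p.1 then (if p.2 then 1 else -1) else 0)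

/-- Position at time `k` of the walk started at `x` with step sequence `s`. -/
def pos {d : ℕ} (x : V d) (s : ℕ → V d) (k : ℕ) : V d :=
  x + ∑ i ∈ Finset.range k, s i

open Classical in
/-- Probability, for the simple random walk, of an event depending on the
first `n` steps (steps beyond `n` are set to `0`): each of the `(2d)^n`
admissible step sequences has equal probability. -/
noncomputable def probN (d n : ℕ) (P : (ℕ → V d) → Prop) : ℝ :=
  (((Fintype.piFinset fun _ : Fin n => steps d).filter
      (fun s => P fun i => if h : i < n then s ⟨i, h⟩ else 0)).card : ℝ) / ((2 * d : ℕ) : ℝ) ^ n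

/-- Expectation of a functional of the first `n` steps of the walk. -/
noncomputable def expN (d n : ℕ) (f : (ℕ → V d) → ℝ) : ℝ :=
  (∑ s ∈ Fintype.piFinset fun _ : Fin n => steps d,
      f fun i => if h : i < n then s ⟨i, h⟩ else 0) / ((2 * d : ℕ) : ℝ) ^ n

/-- Escape probability `P_x(H_A^+ = ∞)`: the walk started at `x` never
hits `A` at a positive time (decreasing limit of the finite-horizon events). -/
noncomputable def esc (d : ℕ) (A : Set (V d)) (x : V d) : ℝ :=
  ⨅ n : ℕ, probN d n (fun s => ∀ k, 1 ≤ k → k ≤ n → pos x s k ∉ A)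

/-- Newtonian capacity `Cap(A) = Σ_{x∈A} P_x(H_A^+ = ∞)`. -/
noncomputable def cap {d : ℕ} (A : Finset (V d)) : ℝ :=
  ∑ x ∈ A, esc d (↑A) x

/-- Green's function `G(z) = Σ_n P_0(S_n = z)`. -/
noncomputable def G (d : ℕ) (z : V d) : ℝ :=
  ∑' n : ℕ, probN d n (fun s => pos 0 s n = z)

/-- Truncated Green's function `G_T(z) = Σ_{n≤T} P_0(S_n = z)`. -/
noncomputable def GT (d T : ℕ) (z : V d) : ℝ :=
  ∑ n ∈ Finset.range (T + 1), probN d n (fun s => pos 0 s n = z)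

/-- Convolution `(G ⋆ G_T)(x) = Σ_y G(x-y) G_T(y)`. -/
noncomputable def GconvGT (d T : ℕ) (x : V d) : ℝ :=
  ∑' y : V d, G d (x - y) * GT d T y

/-- Euclidean norm on `ℤ^d`. -/
noncomputable def nrm {d : ℕ} (x : V d) : ℝ :=
  Real.sqrt (∑ i, ((x i : ℝ)) ^ 2)

/-- The range `{S_k : k ∈ I}` of the walk started at `x` over the set of times `I`. -/
noncomputable def rangeOn {d : ℕ} (x : V d) (s : ℕ → V d) (I : Finset ℕ) : Finset (V d) :=
  I.image (pos x s)

/-- Probability that the walk started at `z` hits both `A` and `B` in finite time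
(increasing limit of the finite-horizon probabilities). -/
noncomputable def hitBothProb (d : ℕ) (A B : Finset (V d)) (z : V d) : ℝ :=
  ⨆ n : ℕ, probN d n (fun s => (∃ k ≤ n, pos z s k ∈ A) ∧ (∃ k ≤ n, pos z s k ∈ B))

/-- The discrete cube `Q(x,r) = [x - r/2, x + r/2)^d ∩ ℤ^d`. -/
def cube {d : ℕ} (x : V d) (r : ℝ) : Set (V d) :=
  {y | ∀ i, (x i : ℝ) - r / 2 ≤ (y i : ℝ) ∧ (y i : ℝ) < (x i : ℝ) + r / 2}

/-- The corrector `ξ_n(T)`. -/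
noncomputable def xi (d n T : ℕ) (s : ℕ → V d) : ℝ :=
  ∑ k ∈ Finset.range (n + 1), ∑ x ∈ rangeOn 0 s (Finset.Icc 0 k),
    esc d (↑(rangeOn 0 s (Finset.Icc 0 k))) x * (GconvGT d T (x - pos 0 s k) / T)

/-- The capacity cross-term `χ_C(A,B) = Cap(A) + Cap(B) - Cap(A ∪ B)`. -/
noncomputable def chiC {d : ℕ} (A B : Finset (V d)) : ℝ := cap A + cap B - cap (A ∪ B)

open Classical in
/-- Conditional expectation, given the first `m` steps (equal to those of `s`),
of a functional of the first `n` steps. -/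
noncomputable def condExpN (d n m : ℕ) (f : (ℕ → V d) → ℝ) (s : ℕ → V d) : ℝ :=
  expN d n (fun s' => if ∀ i < m, s' i = s i then f s' else 0) * ((2 * d : ℕ) : ℝ) ^ m

/-- The compensator `ξ_n^*(T)`. -/
noncomputable def xiStar (d n T : ℕ) (s : ℕ → V d) : ℝ :=
  (1 / (T : ℝ)) * ∑ j ∈ Finset.range T, ∑ l ∈ Finset.Icc 1 (n / T - 1),
    condExpN d (n + T) (j + l * T)
      (fun s' => chiC (rangeOn 0 s' (Finset.Icc j (j + l * T)))
        (rangeOn 0 s' (Finset.Icc (j + l * T) (j + (l + 1) * T)))) s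

/-- `E[Cap(R_n)]`, the expected capacity of the range up to time `n`. -/
noncomputable def expCapRange (d n : ℕ) : ℝ :=
  expN d n (fun s => cap (rangeOn 0 s (Finset.Icc 0 n)))

/-- The maximal capacity `c_n` of the range of a nearest-neighbor path with `n` steps. -/
noncomputable def maxPathCap (d n : ℕ) : ℝ :=
  sSup {y : ℝ | ∃ (x : V d) (s : ℕ → V d), (∀ i, s i ∈ steps d) ∧
    y = cap (rangeOn x s (Finset.Icc 0 n))}

/-- `Γ(A,Λ) = Σ_{x∈A} Σ_{y∈Λ} G(y-x) P_y(H_Λ^+ = ∞)`. -/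
noncomputable def GamFin (d : ℕ) (A : Finset (V d)) (Λ : Set (V d)) : ℝ :=
  ∑ x ∈ A, ∑' y : Λ, G d ((y : V d) - x) * esc d Λ (y : V d)

/-- `P(Γ(R̃_∞, Λ) > t)`, as the increasing limit of the finite-horizon probabilities. -/
noncomputable def PGam (d : ℕ) (Λ : Set (V d)) (t : ℝ) : ℝ :=
  ⨆ N : ℕ, probN d N (fun s => t < GamFin d (rangeOn 0 s (Finset.Icc 0 N)) Λ)

/-- `E_x[Γ(R̃_∞, Λ)]`, as the increasing limit of the finite-horizon expectations. -/
noncomputable def EGam (d : ℕ) (x : V d) (Λ : Set (V d)) : ℝ :=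
  ⨆ N : ℕ, expN d N (fun s => GamFin d (rangeOn x s (Finset.Icc 0 N)) Λ)

/-- The law of the first `n` steps of two independent simple random walks:
uniform measure on pairs of admissible step sequences of length `n`. -/
noncomputable def pairLevel (d n : ℕ) : Measure ((Fin n → V d) × (Fin n → V d)) :=
  (((2 * d : ℕ) : ℝ≥0∞) ^ (2 * n))⁻¹ •
    ∑ a ∈ Fintype.piFinset fun _ : Fin n => steps d,
      ∑ b ∈ Fintype.piFinset fun _ : Fin n => steps d, Measure.dirac (a, b)

open Classical in
/-- `Γ(R̃_∞, R_∞) = Σ_{x ∈ R̃_∞} Σ_{y ∈ R_∞} G(y-x) P_y(H_{R_∞}^+ = ∞)` for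
two (step sequences of) walks, with values in `ℝ≥0∞`. -/
noncomputable def gammaInf (d : ℕ) (sA sB : ℕ → V d) : ℝ≥0∞ :=
  ∑' x : V d, ∑' y : V d,
    if x ∈ Set.range (pos (0 : V d) sA) ∧ y ∈ Set.range (pos (0 : V d) sB) then
      ENNReal.ofReal (G d (y - x) * esc d (Set.range (pos (0 : V d) sB)) y)
    else 0

/-! ### Single steps and finite-horizon probabilities -/

lemma sum_steps {d : ℕ} {M : Type*} [AddCommMonoid M] (g : V d → M) :
    ∑ e ∈ steps d, g e = ∑ i : Fin d, (g (Pi.single i 1) + g (Pi.single i (-1))) := by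
  have hform : ∀ (i : Fin d) (c : ℤ),
      (fun j => if j = i then c else 0 : V d) = Pi.single i c := by
    intro i c
    funext j
    simp [Pi.single_apply]
  have hinj : Function.Injective (fun p : Fin d × Bool =>
      (fun j => if j = p.1 then (if p.2 then 1 else -1) else 0 : V d)) := by
    rintro ⟨i, b⟩ ⟨j, c⟩ h
    have hi := congrFun h i
    have hj := congrFun h j
    by_cases hij : i = j
    · subst hij
      cases b <;> cases c <;> simp_all
    · cases b <;> cases c <;> simp_all
  rw [steps, Finset.sum_image hinj.injOn, Fintype.sum_prod_type]
  refine Finset.sum_congr rfl fun i _ => ?_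
  simp [hform]

lemma card_steps (d : ℕ) : (steps d).card = 2 * d := by
  rw [Finset.card_eq_sum_ones, sum_steps]
  simp [mul_comm]

lemma mem_steps {d : ℕ} {e : V d} :
    e ∈ steps d ↔ ∃ i, e = Pi.single i 1 ∨ e = Pi.single i (-1) := by
  simp only [steps, Finset.mem_image, Finset.mem_univ, true_and, Prod.exists, Bool.exists_bool]
  refine exists_congr fun i => ?_
  have h : ∀ c : ℤ, (fun j => if j = i then c else 0 : V d) = Pi.single i c := by
    intro c
    funext j
    simp [Pi.single_apply]
  simp only [h, if_true, Bool.false_eq_true, if_false]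
  tauto

lemma neg_mem_steps {d : ℕ} {e : V d} (he : e ∈ steps d) : -e ∈ steps d := by
  rw [mem_steps] at he ⊢
  obtain ⟨i, rfl | rfl⟩ := he
  · exact ⟨i, Or.inr (by rw [Pi.single_neg])⟩
  · exact ⟨i, Or.inl (by rw [Pi.single_neg, neg_neg])⟩

/-- Extension by zero of a finite step sequence. -/
def extend {d n : ℕ} (s : Fin n → V d) : ℕ → V d :=
  fun i => if h : i < n then s ⟨i, h⟩ else 0

/-- The step sequence with first step `a`, followed by `s`. -/
def consStep {d : ℕ} (a : V d) (s : ℕ → V d) : ℕ → V d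
  | 0 => a
  | k + 1 => s k

lemma pos_zero {d : ℕ} (x : V d) (s : ℕ → V d) : pos x s 0 = x := by simp [pos]

lemma pos_succ {d : ℕ} (x : V d) (s : ℕ → V d) (k : ℕ) :
    pos x s (k + 1) = pos x s k + s k := by
  simp [pos, Finset.sum_range_succ, add_assoc]

lemma pos_consStep_succ {d : ℕ} (x a : V d) (s : ℕ → V d) (k : ℕ) :
    pos x (consStep a s) (k + 1) = pos (x + a) s k := by
  simp only [pos, Finset.sum_range_succ', consStep]
  abel

lemma pos_congr {d : ℕ} (x : V d) {s t : ℕ → V d} {k : ℕ} (h : ∀ i < k, s i = t i) :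
    pos x s k = pos x t k := by
  simp only [pos]
  congr 1
  exact Finset.sum_congr rfl fun i hi => h i (Finset.mem_range.1 hi)

lemma rangeOn_congr {d : ℕ} (x : V d) {s t : ℕ → V d} {n : ℕ} (h : ∀ i < n, s i = t i) :
    rangeOn x s (Finset.Icc 0 n) = rangeOn x t (Finset.Icc 0 n) := by
  refine Finset.image_congr fun k hk => pos_congr x fun i hi => h i ?_
  have := (Finset.mem_Icc.1 (Finset.mem_coe.1 hk)).2
  omega

lemma rangeOn_succ {d : ℕ} (x : V d) (s : ℕ → V d) (n : ℕ) :
    rangeOn x s (Finset.Icc 0 (n + 1))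
      = insert (pos x s (n + 1)) (rangeOn x s (Finset.Icc 0 n)) := by
  rw [rangeOn, rangeOn, ← Finset.image_insert]
  congr 1
  ext k
  simp only [Finset.mem_Icc, Finset.mem_insert]
  omega

lemma pos_mem_rangeOn {d : ℕ} (x : V d) (s : ℕ → V d) {k n : ℕ} (h : k ≤ n) :
    pos x s k ∈ rangeOn x s (Finset.Icc 0 n) :=
  Finset.mem_image_of_mem _ (Finset.mem_Icc.2 ⟨Nat.zero_le _, h⟩)

lemma extend_cons {d n : ℕ} (a : V d) (s : Fin n → V d) :
    extend (Fin.cons a s : Fin (n + 1) → V d) = consStep a (extend s) := by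
  funext i
  cases i with
  | zero => simp [extend, consStep]
  | succ k =>
    simp only [extend, consStep, Nat.add_lt_add_iff_right]
    split_ifs with h
    · exact Fin.cons_succ (α := fun _ => V d) a s ⟨k, h⟩
    · rfl

lemma sum_piFinset_succ {d n : ℕ} {M : Type*} [AddCommMonoid M] (F : (Fin (n + 1) → V d) → M) :
    ∑ s ∈ Fintype.piFinset (fun _ : Fin (n + 1) => steps d), F s
      = ∑ a ∈ steps d, ∑ s ∈ Fintype.piFinset (fun _ : Fin n => steps d), F (Fin.cons a s) := by
  rw [← Finset.sum_product']
  refine Finset.sum_nbij' (fun s => (s 0, Fin.tail s)) (fun p => Fin.cons p.1 p.2) ?_ ?_ ?_ ?_ ?_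
  · intro s hs
    simp only [Finset.mem_product, Fintype.mem_piFinset] at hs ⊢
    exact ⟨hs 0, fun i => hs i.succ⟩
  · rintro ⟨a, s⟩ hs
    simp only [Finset.mem_product, Fintype.mem_piFinset] at hs ⊢
    exact Fin.cases hs.1 hs.2
  · intro s _
    exact Fin.cons_self_tail s
  · rintro ⟨a, s⟩ _
    simp
  · intro s _
    simp

lemma card_piFinset_steps (d n : ℕ) :
    ((Fintype.piFinset fun _ : Fin n => steps d).card : ℝ) = ((2 * d : ℕ) : ℝ) ^ n := by
  simp [Fintype.card_piFinset, card_steps]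

open Classical in
lemma probN_eq_sum (d n : ℕ) (P : (ℕ → V d) → Prop) :
    probN d n P = (∑ s ∈ Fintype.piFinset (fun _ : Fin n => steps d),
      if P (extend s) then (1 : ℝ) else 0) / ((2 * d : ℕ) : ℝ) ^ n := by
  rw [probN, Finset.card_filter]
  push_cast
  rfl

lemma probN_succ (d n : ℕ) (P : (ℕ → V d) → Prop) :
    probN d (n + 1) P
      = (∑ a ∈ steps d, probN d n fun s => P (consStep a s)) / ((2 * d : ℕ) : ℝ) := by
  classical
  simp only [probN_eq_sum, sum_piFinset_succ]
  rw [← Finset.sum_div, div_div, pow_succ]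
  refine congrArg (· / _) (Finset.sum_congr rfl fun a _ => Finset.sum_congr rfl fun s _ => ?_)
  exact congrArg (fun t => if P t then (1 : ℝ) else 0) (extend_cons a s)

lemma probN_nonneg (d n : ℕ) (P : (ℕ → V d) → Prop) : 0 ≤ probN d n P := by
  unfold probN
  positivity

lemma probN_mono (d n : ℕ) {P Q : (ℕ → V d) → Prop} (h : ∀ s, P s → Q s) :
    probN d n P ≤ probN d n Q := by
  classical
  rw [probN_eq_sum, probN_eq_sum]
  gcongr with s hs
  split_ifs with h1 h2 <;> first | exact absurd (h _ h1) h2 | norm_num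

open Classical in
lemma probN_zero (d : ℕ) (P : (ℕ → V d) → Prop) :
    probN d 0 P = if P (fun _ => 0) then 1 else 0 := by
  rw [probN_eq_sum]
  have : ∀ s : Fin 0 → V d, extend s = fun _ => 0 := fun s => by
    funext i
    simp [extend]
  simp [this]

/-! ### Capacity bounds -/

lemma bddBelow_range_probN (d : ℕ) (P : ℕ → (ℕ → V d) → Prop) :
    BddBelow (Set.range fun n => probN d n (P n)) :=
  ⟨0, by rintro _ ⟨n, rfl⟩; exact probN_nonneg _ _ _⟩

lemma esc_le_one (d : ℕ) (A : Set (V d)) (x : V d) : esc d A x ≤ 1 := by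
  refine (ciInf_le (bddBelow_range_probN d _) 0).trans ?_
  classical
  rw [probN_zero]
  split_ifs <;> norm_num

lemma cap_rangeOn_le {d : ℕ} (x : V d) (s : ℕ → V d) (n : ℕ) :
    cap (rangeOn x s (Finset.Icc 0 n)) ≤ n + 1 := by
  have h : (rangeOn x s (Finset.Icc 0 n)).card ≤ n + 1 :=
    Finset.card_image_le.trans (by simp)
  calc cap (rangeOn x s (Finset.Icc 0 n))
      ≤ ∑ _x ∈ rangeOn x s (Finset.Icc 0 n), (1 : ℝ) :=
        Finset.sum_le_sum fun y _ => esc_le_one _ _ _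
    _ ≤ n + 1 := by
        simp only [Finset.sum_const, nsmul_eq_mul, mul_one]
        exact_mod_cast h

lemma cap_le_maxPathCap {d : ℕ} (x : V d) (s : ℕ → V d) (n : ℕ) (hs : ∀ i, s i ∈ steps d) :
    cap (rangeOn x s (Finset.Icc 0 n)) ≤ maxPathCap d n := by
  refine le_csSup ⟨n + 1, ?_⟩ ⟨x, s, hs, rfl⟩
  rintro _ ⟨x, s, -, rfl⟩
  exact cap_rangeOn_le x s n

lemma maxPathCap_le (d n : ℕ) : maxPathCap d n ≤ n + 1 := by
  refine Real.sSup_le ?_ (by positivity)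
  rintro _ ⟨x, s, -, rfl⟩
  exact cap_rangeOn_le x s n

/-! ### A positive superharmonic function -/

/-- The function `2 / (2 + Σ_{i ∈ T} x_i²)`, equal to `1` exactly where the coordinates
in `T` vanish. -/
noncomputable def barrier {d : ℕ} (T : Finset (Fin d)) (x : V d) : ℝ :=
  2 / (2 + ∑ i ∈ T, (x i : ℝ) ^ 2)

lemma sum_sq_add_single {d : ℕ} (T : Finset (Fin d)) (x : V d) (i : Fin d) (c : ℤ) :
    ∑ j ∈ T, ((x + Pi.single i c : V d) j : ℝ) ^ 2
      = ∑ j ∈ T, (x j : ℝ) ^ 2 + if i ∈ T then 2 * c * x i + (c : ℝ) ^ 2 else 0 := by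
  have h : ∀ j, ((x + Pi.single i c : V d) j : ℝ) ^ 2
      = (x j : ℝ) ^ 2 + if i = j then 2 * c * x i + (c : ℝ) ^ 2 else 0 := by
    intro j
    by_cases hij : i = j
    · subst hij
      simp
      ring
    · simp [hij, Ne.symm hij]
  simp only [h, Finset.sum_add_distrib, Finset.sum_ite_eq]

lemma barrier_le_one {d : ℕ} (T : Finset (Fin d)) (x : V d) : barrier T x ≤ 1 := by
  have : 0 ≤ ∑ i ∈ T, (x i : ℝ) ^ 2 := Finset.sum_nonneg fun i _ => sq_nonneg _
  rw [barrier, div_le_one (by positivity)]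
  linarith

lemma barrier_nonneg {d : ℕ} (T : Finset (Fin d)) (x : V d) : 0 ≤ barrier T x := by
  unfold barrier
  positivity

lemma barrier_single_pair_le (q a : ℝ) (ha : a ^ 2 ≤ q) :
    2 / (2 + (q + (2 * 1 * a + 1 ^ 2))) + 2 / (2 + (q + (2 * (-1) * a + (-1) ^ 2)))
      ≤ 4 / (q + 3) + a ^ 2 * (16 / ((q + 3) * ((q + 3) ^ 2 - 4 * q))) := by
  have hq : 0 ≤ q := (sq_nonneg a).trans ha
  have h1 : 0 < q + 3 + 2 * a := by nlinarith [sq_nonneg (a + 1)]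
  have h2 : 0 < q + 3 - 2 * a := by nlinarith [sq_nonneg (a - 1)]
  have h3 : 0 < (q + 3) ^ 2 - 4 * q := by nlinarith
  have h4 : 0 < (q + 3) ^ 2 - 4 * a ^ 2 := by nlinarith
  have e : 2 / (2 + (q + (2 * 1 * a + 1 ^ 2))) + 2 / (2 + (q + (2 * (-1) * a + (-1) ^ 2)))
      = 4 / (q + 3) + a ^ 2 * (16 / ((q + 3) * ((q + 3) ^ 2 - 4 * a ^ 2))) := by
    have e1 : 2 + (q + (2 * 1 * a + 1 ^ 2)) = q + 3 + 2 * a := by ring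
    have e2 : 2 + (q + (2 * (-1) * a + (-1) ^ 2)) = q + 3 - 2 * a := by ring
    have e3 : (q + 3) ^ 2 - 4 * a ^ 2 = (q + 3 + 2 * a) * (q + 3 - 2 * a) := by ring
    rw [e1, e2, e3]
    field_simp
    ring
  rw [e]
  gcongr

lemma sum_barrier_le {d : ℕ} {T : Finset (Fin d)} (hT : T.card = 4) (x : V d) :
    ∑ e ∈ steps d, barrier T (x + e) ≤ ((2 * d : ℕ) : ℝ) * barrier T x := by
  set q : ℝ := ∑ i ∈ T, (x i : ℝ) ^ 2 with hq
  have hq0 : 0 ≤ q := Finset.sum_nonneg fun i _ => sq_nonneg _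
  set D : ℝ := 16 / ((q + 3) * ((q + 3) ^ 2 - 4 * q)) with hD
  have hpos : 0 < (q + 3) ^ 2 - 4 * q := by nlinarith
  have key : 4 * (4 / (q + 3)) + q * D ≤ 4 * (2 * barrier T x) := by
    rw [barrier, ← hq, hD, ← sub_nonneg]
    have : 4 * (2 * (2 / (2 + q))) - (4 * (4 / (q + 3)) + q * (16 / ((q + 3) * ((q + 3) ^ 2 - 4 * q))))
        = 144 / ((2 + q) * (q + 3) * ((q + 3) ^ 2 - 4 * q)) := by
      have := hpos.ne'
      field_simp
      ring
    rw [this]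
    positivity
  have hbound : ∀ i : Fin d, barrier T (x + Pi.single i 1) + barrier T (x + Pi.single i (-1))
      ≤ 2 * barrier T x
        + if i ∈ T then 4 / (q + 3) + (x i : ℝ) ^ 2 * D - 2 * barrier T x else 0 := by
    intro i
    simp only [barrier, sum_sq_add_single, ← hq]
    by_cases hi : i ∈ T
    · simp only [hi, if_true]
      have := barrier_single_pair_le q (x i)
        (Finset.single_le_sum (f := fun i => (x i : ℝ) ^ 2) (fun i _ => sq_nonneg _) hi)
      push_cast
      linarith
    · simp only [hi, if_false]
      apply le_of_eq
      ring
  rw [sum_steps]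
  refine (Finset.sum_le_sum fun i _ => hbound i).trans ?_
  have hqD : ∑ i ∈ T, (x i : ℝ) ^ 2 * D = q * D := (Finset.sum_mul _ _ _).symm
  rw [Finset.sum_add_distrib, Finset.sum_ite_mem, Finset.univ_inter, Finset.sum_sub_distrib,
    Finset.sum_add_distrib, hqD]
  simp only [Finset.sum_const, Finset.card_univ, Fintype.card_fin, hT, nsmul_eq_mul]
  push_cast
  linarith

lemma one_sub_barrier_le_probN {d : ℕ} (hd : 0 < d) {T : Finset (Fin d)} (hT : T.card = 4)
    (n : ℕ) (x : V d) :
    1 - barrier T x ≤ probN d n (fun s => ∀ k ≤ n, ∃ i ∈ T, pos x s k i ≠ 0) := by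
  classical
  by_cases hx : ∃ i ∈ T, x i ≠ 0
  · induction n generalizing x with
    | zero =>
      rw [probN_zero, if_pos]
      · linarith [barrier_nonneg T x]
      · intro k hk
        rw [Nat.le_zero.1 hk, pos_zero]
        exact hx
    | succ n ih =>
      have hih : ∀ y : V d, 1 - barrier T y
          ≤ probN d n (fun s => ∀ k ≤ n, ∃ i ∈ T, pos y s k i ≠ 0) := by
        intro y
        by_cases hy : ∃ i ∈ T, y i ≠ 0
        · exact ih y hy
        · push Not at hy
          have : barrier T y = 1 := by
            rw [barrier, Finset.sum_eq_zero fun i hi => by simp [hy i hi]]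
            norm_num
          rw [this, sub_self]
          exact probN_nonneg _ _ _
      have hdpos : (0 : ℝ) < ((2 * d : ℕ) : ℝ) := by exact_mod_cast (by omega)
      rw [probN_succ, le_div_iff₀ hdpos]
      calc (1 - barrier T x) * ((2 * d : ℕ) : ℝ)
          ≤ ∑ e ∈ steps d, (1 - barrier T (x + e)) := by
            rw [Finset.sum_sub_distrib, Finset.sum_const, card_steps, nsmul_eq_mul]
            linarith [sum_barrier_le hT x]
        _ ≤ _ := by
            refine Finset.sum_le_sum fun e _ => (hih (x + e)).trans (probN_mono d n ?_)
            intro s hs k hk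
            cases k with
            | zero => rw [pos_zero]; exact hx
            | succ k => rw [pos_consStep_succ]; exact hs k (by omega)
  · push Not at hx
    have : barrier T x = 1 := by
      rw [barrier, Finset.sum_eq_zero fun i hi => by simp [hx i hi]]
      norm_num
    rw [this, sub_self]
    exact probN_nonneg _ _ _

lemma esc_ge {d : ℕ} {T : Finset (Fin d)} (hT : T.card = 4) {A : Set (V d)}
    (hA : ∀ y ∈ A, ∀ i ∈ T, y i = 0) {x : V d} (hx : x ∈ A) :
    4 / (3 * (d : ℝ)) ≤ esc d A x := by
  classical
  have hd4 : 4 ≤ d := by simpa [hT] using Finset.card_le_univ T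
  have hd0 : (4 : ℝ) ≤ d := by exact_mod_cast hd4
  refine le_ciInf fun n => ?_
  cases n with
  | zero =>
    rw [probN_zero, if_pos (by intro k h1 h2; omega), div_le_one (by linarith)]
    linarith
  | succ n =>
    have hdpos : (0 : ℝ) < ((2 * d : ℕ) : ℝ) := by exact_mod_cast (by omega)
    rw [probN_succ, le_div_iff₀ hdpos]
    have hsum : ∑ e ∈ steps d, (1 - barrier T (x + e)) = 8 / 3 := by
      have hq : ∑ j ∈ T, (x j : ℝ) ^ 2 = 0 :=
        Finset.sum_eq_zero fun i hi => by simp [hA x hx i hi]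
      have hterm : ∀ i : Fin d, (1 - barrier T (x + Pi.single i 1))
          + (1 - barrier T (x + Pi.single i (-1))) = if i ∈ T then (2 / 3 : ℝ) else 0 := by
        intro i
        simp only [barrier, sum_sq_add_single, hq]
        by_cases hi : i ∈ T
        · simp only [hi, if_true, hA x hx i hi]
          norm_num
        · simp [hi]
      rw [sum_steps, Finset.sum_congr rfl fun i _ => hterm i, Finset.sum_ite_mem,
        Finset.univ_inter, Finset.sum_const, hT]
      norm_num
    calc 4 / (3 * (d : ℝ)) * ((2 * d : ℕ) : ℝ) = 8 / 3 := by
          push_cast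
          field_simp
          norm_num
      _ = ∑ e ∈ steps d, (1 - barrier T (x + e)) := hsum.symm
      _ ≤ _ := by
          refine Finset.sum_le_sum fun e _ =>
            (one_sub_barrier_le_probN (by omega) hT n (x + e)).trans (probN_mono d n ?_)
          intro s hs k hk1 hk2 hmem
          obtain ⟨k, rfl⟩ : ∃ j, k = j + 1 := ⟨k - 1, by omega⟩
          rw [pos_consStep_succ] at hmem
          obtain ⟨i, hi, hne⟩ := hs k (by omega)
          exact hne (hA _ hmem i hi)

/-- A straight line has capacity growing linearly with its length. -/
lemma maxPathCap_ge {d : ℕ} (hd : 5 ≤ d) (n : ℕ) :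
    4 / (3 * (d : ℝ)) * (n + 1) ≤ maxPathCap d n := by
  let i₀ : Fin d := ⟨0, by omega⟩
  let T : Finset (Fin d) := Finset.univ.map (Fin.succEmb 4 |>.trans (Fin.castLEEmb hd))
  have hT : T.card = 4 := by simp [T]
  have hi₀ : i₀ ∉ T := by
    simp only [T, i₀, Finset.mem_map, Finset.mem_univ, true_and, not_exists]
    intro j hj
    simpa using congrArg Fin.val hj
  let s : ℕ → V d := fun _ => Pi.single i₀ 1
  have hs : ∀ i, s i ∈ steps d := fun _ => mem_steps.2 ⟨i₀, Or.inl rfl⟩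
  have hpos : ∀ k, pos 0 s k = Pi.single i₀ (k : ℤ) := by
    intro k
    induction k with
    | zero => simp [pos_zero]
    | succ k ih => rw [pos_succ, ih, ← Pi.single_add]; push_cast; rfl
  have hcard : (rangeOn 0 s (Finset.Icc 0 n)).card = n + 1 := by
    rw [rangeOn, Finset.card_image_of_injective]
    · simp
    · intro a b hab
      simp only [hpos] at hab
      exact_mod_cast Pi.single_injective i₀ hab
  refine le_trans ?_ (cap_le_maxPathCap 0 s n hs)
  calc 4 / (3 * (d : ℝ)) * (n + 1)
      = ∑ _y ∈ rangeOn 0 s (Finset.Icc 0 n), 4 / (3 * (d : ℝ)) := by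
        rw [Finset.sum_const, hcard, nsmul_eq_mul]
        push_cast
        ring
    _ ≤ _ := Finset.sum_le_sum fun y hy => esc_ge hT (fun z hz i hi => by
        obtain ⟨k, -, rfl⟩ := Finset.mem_image.1 (Finset.mem_coe.1 hz)
        rw [hpos, Pi.single_eq_of_ne]
        rintro rfl
        exact hi₀ hi) (Finset.mem_coe.2 hy)

/-! ### Removing double backtracks -/

/-- After the step `t (2i+1)`, the walk steps back and then repeats that step. -/
def IsDoubleBacktrack {d : ℕ} (t : ℕ → V d) (i : ℕ) : Prop :=
  t (2 * i + 2) = -t (2 * i + 1) ∧ t (2 * i + 3) = t (2 * i + 1)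

open Classical in
/-- The number of double backtracks among the first `2(K+1)` steps. -/
noncomputable def numBacktracks {d : ℕ} (K : ℕ) (t : ℕ → V d) : ℕ :=
  ((Finset.range K).filter fun i => IsDoubleBacktrack t i).card

lemma exists_reduced_path {d : ℕ} (t : ℕ → V d) (K : ℕ) (ht : ∀ i, t i ∈ steps d) :
    ∃ (m : ℕ) (t' : ℕ → V d), m + numBacktracks K t = K + 1 ∧ (∀ i, t' i ∈ steps d) ∧
      rangeOn 0 t' (Finset.Icc 0 (2 * m)) = rangeOn 0 t (Finset.Icc 0 (2 * (K + 1))) ∧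
      pos 0 t' (2 * m) = pos 0 t (2 * (K + 1)) := by
  classical
  induction K with
  | zero => exact ⟨1, t, by simp [numBacktracks], ht, rfl, rfl⟩
  | succ K ih =>
    obtain ⟨m, t', hm, ht', hr, hp⟩ := ih
    have e2 : 2 * (K + 1 + 1) = 2 * (K + 1) + 1 + 1 := by ring
    by_cases hb : IsDoubleBacktrack t K
    · refine ⟨m, t', ?_, ht', ?_, ?_⟩
      · have : numBacktracks (K + 1) t = numBacktracks K t + 1 := by
          rw [numBacktracks, Finset.range_add_one, Finset.filter_insert, if_pos hb,
            Finset.card_insert_of_notMem (by simp), numBacktracks]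
        omega
      · have h1 : pos 0 t (2 * (K + 1) + 1) = pos 0 t (2 * K + 1) := by
          rw [pos_succ, show 2 * (K + 1) = 2 * K + 1 + 1 by ring, pos_succ, hb.1]
          abel
        have h2 : pos 0 t (2 * (K + 1) + 1 + 1) = pos 0 t (2 * (K + 1)) := by
          rw [pos_succ, h1, show 2 * (K + 1) + 1 = 2 * K + 3 by ring, hb.2,
            show 2 * (K + 1) = 2 * K + 1 + 1 by ring, ← pos_succ]
        rw [e2, rangeOn_succ, rangeOn_succ, h2, h1, hr,
          Finset.insert_eq_of_mem (pos_mem_rangeOn 0 t (show 2 * K + 1 ≤ 2 * (K + 1) by omega)),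
          Finset.insert_eq_of_mem (pos_mem_rangeOn 0 t le_rfl)]
      · rw [hp, e2, pos_succ, pos_succ, show 2 * (K + 1) + 1 = 2 * K + 3 by ring,
          show 2 * (K + 1) = 2 * K + 2 by ring, hb.1,
          hb.2]
        abel
    · let t'' : ℕ → V d := fun i =>
        if i < 2 * m then t' i else t (2 * (K + 1) + (i - 2 * m))
      have hlt : ∀ i < 2 * m, t'' i = t' i := fun i hi => if_pos hi
      have h0 : t'' (2 * m) = t (2 * (K + 1)) := by simp [t'']
      have h1 : t'' (2 * m + 1) = t (2 * (K + 1) + 1) := by simp [t'']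
      have p0 : pos 0 t'' (2 * m) = pos 0 t (2 * (K + 1)) := by rw [pos_congr 0 hlt, hp]
      have p1 : pos 0 t'' (2 * m + 1) = pos 0 t (2 * (K + 1) + 1) := by
        rw [pos_succ, pos_succ, p0, h0]
      have p2 : pos 0 t'' (2 * m + 1 + 1) = pos 0 t (2 * (K + 1) + 1 + 1) := by
        rw [pos_succ, pos_succ _ _ (2 * (K + 1) + 1), p1, h1]
      have em : 2 * (m + 1) = 2 * m + 1 + 1 := by ring
      refine ⟨m + 1, t'', ?_, ?_, ?_, ?_⟩
      · have : numBacktracks (K + 1) t = numBacktracks K t := by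
          rw [numBacktracks, Finset.range_add_one, Finset.filter_insert, if_neg hb, numBacktracks]
        omega
      · intro i
        simp only [t'']
        split_ifs
        exacts [ht' i, ht _]
      · rw [e2, em, rangeOn_succ, rangeOn_succ, rangeOn_succ, rangeOn_succ, p1, p2,
          rangeOn_congr 0 hlt, hr]
      · rw [e2, em, p2]

lemma cap_le_maxPathCap_reduced {d : ℕ} (hd : 0 < d) (K : ℕ) (t : ℕ → V d)
    (ht : ∀ i < 2 * (K + 1), t i ∈ steps d) :
    ∃ m : ℕ, m + numBacktracks K t = K + 1 ∧
      cap (rangeOn 0 t (Finset.Icc 0 (2 * (K + 1)))) ≤ maxPathCap d (2 * m) := by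
  classical
  let u : ℕ → V d := fun i => if i < 2 * (K + 1) then t i else Pi.single ⟨0, hd⟩ 1
  have hut : ∀ i < 2 * (K + 1), u i = t i := fun i hi => if_pos hi
  have hu : ∀ i, u i ∈ steps d := by
    intro i
    simp only [u]
    split_ifs with h
    exacts [ht i h, mem_steps.2 ⟨_, Or.inl rfl⟩]
  have hn : numBacktracks K u = numBacktracks K t := by
    unfold numBacktracks
    congr 1
    refine Finset.filter_congr fun i hi => ?_
    have := Finset.mem_range.1 hi
    simp only [IsDoubleBacktrack, hut (2 * i + 1) (by omega), hut (2 * i + 2) (by omega),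
      hut (2 * i + 3) (by omega)]
  obtain ⟨m, t', hm, ht', hr, -⟩ := exists_reduced_path u K hu
  refine ⟨m, hn ▸ hm, ?_⟩
  rw [← rangeOn_congr 0 hut, ← hr]
  exact cap_le_maxPathCap 0 t' _ ht'

/-! ### The expected number of double backtracks -/

open Classical in
lemma card_isDoubleBacktrack_ge {d N i : ℕ} (hd : 0 < d) (hi : 2 * i + 3 < N) :
    ((2 * d : ℕ) : ℝ) ^ N / ((2 * d : ℕ) : ℝ) ^ 2
      ≤ (((Fintype.piFinset fun _ : Fin N => steps d).filter
          fun s => IsDoubleBacktrack (extend s) i).card : ℝ) := by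
  let a : Fin N := ⟨2 * i + 1, by omega⟩
  let b : Fin N := ⟨2 * i + 2, by omega⟩
  let c : Fin N := ⟨2 * i + 3, hi⟩
  let F : V d → Fin N → Finset (V d) := fun e j =>
    if j = a then {e} else if j = b then {-e} else if j = c then {e} else steps d
  have hab : a ≠ b := by simp [a, b]
  have hac : a ≠ c := by simp [a, c]
  have hbc : b ≠ c := by simp [b, c]
  have hdpos : (0 : ℝ) < ((2 * d : ℕ) : ℝ) := by exact_mod_cast (by omega)
  have hsub : (steps d).biUnion (fun e => Fintype.piFinset (F e)) ⊆
      (Fintype.piFinset fun _ : Fin N => steps d).filter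
          fun s => IsDoubleBacktrack (extend s) i := by
    intro s hs
    obtain ⟨e, he, hse⟩ := Finset.mem_biUnion.1 hs
    rw [Fintype.mem_piFinset] at hse
    have ha : s a = e := by simpa [F] using hse a
    have hb : s b = -e := by simpa [F, hab.symm] using hse b
    have hc : s c = e := by simpa [F, hac.symm, hbc.symm] using hse c
    refine Finset.mem_filter.2 ⟨Fintype.mem_piFinset.2 fun j => ?_, ?_⟩
    · have := hse j
      simp only [F] at this
      split_ifs at this with h1 h2 h3
      · rw [Finset.mem_singleton.1 this]; exact he
      · rw [Finset.mem_singleton.1 this]; exact neg_mem_steps he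
      · rw [Finset.mem_singleton.1 this]; exact he
      · exact this
    · have e1 : extend s (2 * i + 1) = s a := dif_pos a.2
      have e2 : extend s (2 * i + 2) = s b := dif_pos b.2
      have e3 : extend s (2 * i + 3) = s c := dif_pos c.2
      rw [IsDoubleBacktrack, e1, e2, e3, ha, hb, hc]
      exact ⟨rfl, rfl⟩
  have hdisj : ∀ e ∈ steps d, ∀ e' ∈ steps d, e ≠ e' →
      Disjoint (Fintype.piFinset (F e)) (Fintype.piFinset (F e')) := by
    intro e _ e' _ hne
    refine Finset.disjoint_left.2 fun s hs hs' => hne ?_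
    have h1 := Fintype.mem_piFinset.1 hs a
    have h2 := Fintype.mem_piFinset.1 hs' a
    simp only [F, if_true, Finset.mem_singleton] at h1 h2
    rw [← h1, h2]
  have hcard : ∀ e, ((Fintype.piFinset (F e)).card : ℝ) * ((2 * d : ℕ) : ℝ) ^ 3
      = ((2 * d : ℕ) : ℝ) ^ N := by
    intro e
    have hfac : ∀ j, ((F e j).card : ℝ) * ((if j = a then ((2 * d : ℕ) : ℝ) else 1) *
        (if j = b then ((2 * d : ℕ) : ℝ) else 1) * (if j = c then ((2 * d : ℕ) : ℝ) else 1))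
        = ((2 * d : ℕ) : ℝ) := by
      intro j
      simp only [F]
      by_cases h1 : j = a
      · subst h1; simp [hab, hac]
      by_cases h2 : j = b
      · subst h2; simp [h1, hbc]
      by_cases h3 : j = c
      · subst h3; simp [h1, h2]
      simp [h1, h2, h3, card_steps]
    have := Finset.prod_congr (rfl : (Finset.univ : Finset (Fin N)) = _) fun j _ => hfac j
    simp only [Finset.prod_mul_distrib, Finset.prod_ite_eq', Finset.mem_univ, if_true,
      Finset.prod_const, Finset.card_univ, Fintype.card_fin] at this
    rw [Fintype.card_piFinset, ← this]
    push_cast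
    ring
  refine le_trans (le_of_eq ?_) (Nat.cast_le.2 (Finset.card_le_card hsub))
  rw [Finset.card_biUnion hdisj]
  rw [Nat.cast_sum, Finset.sum_congr rfl fun e _ => eq_div_of_mul_eq (pow_ne_zero 3 hdpos.ne') (hcard e),
    Finset.sum_const, card_steps, nsmul_eq_mul]
  push_cast at hdpos ⊢
  field_simp

lemma sum_numBacktracks_ge {d : ℕ} (hd : 0 < d) (K : ℕ) :
    (K : ℝ) * (((2 * d : ℕ) : ℝ) ^ (2 * (K + 1)) / ((2 * d : ℕ) : ℝ) ^ 2)
      ≤ ∑ s ∈ Fintype.piFinset (fun _ : Fin (2 * (K + 1)) => steps d),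
          (numBacktracks K (extend s) : ℝ) := by
  classical
  simp only [numBacktracks, Finset.card_filter]
  push_cast
  rw [Finset.sum_comm]
  calc _ = ∑ _i ∈ Finset.range K,
        (((2 * d : ℕ) : ℝ) ^ (2 * (K + 1)) / ((2 * d : ℕ) : ℝ) ^ 2) := by
        rw [Finset.sum_const, Finset.card_range, nsmul_eq_mul]
        push_cast
        rfl
    _ ≤ _ := Finset.sum_le_sum fun i hi => by
        have := card_isDoubleBacktrack_ge (d := d) (N := 2 * (K + 1)) (i := i) hd
          (by have := Finset.mem_range.1 hi; omega)
        rw [Finset.card_filter] at this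
        push_cast at this ⊢
        exact this

/-- An affine bound on `maxPathCap` improves on the walk by the density of double backtracks. -/
lemma expCapRange_le {d : ℕ} (hd : 0 < d) {g C : ℝ} (hg : 0 ≤ g)
    (h : ∀ m : ℕ, maxPathCap d m ≤ g * m + C) (K : ℕ) :
    expCapRange d (2 * (K + 1))
      ≤ g * (2 * (K + 1) - 2 * (K * (1 / ((2 * d : ℕ) : ℝ) ^ 2))) + C := by
  have hdpos : (0 : ℝ) < ((2 * d : ℕ) : ℝ) := by exact_mod_cast (by omega)
  rw [expCapRange, expN, div_le_iff₀ (pow_pos hdpos _)]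
  calc _ ≤ ∑ s ∈ Fintype.piFinset (fun _ : Fin (2 * (K + 1)) => steps d),
        (g * (2 * (K + 1)) + C - 2 * g * (numBacktracks K (extend s) : ℝ)) := by
        refine Finset.sum_le_sum fun s hs => ?_
        obtain ⟨m, hm, hle⟩ := cap_le_maxPathCap_reduced hd K (extend s) fun i hi => by
          rw [extend, dif_pos hi]
          exact Fintype.mem_piFinset.1 hs _
        have hm' : (m : ℝ) + numBacktracks K (extend s) = K + 1 := by exact_mod_cast hm
        have := h (2 * m)
        push_cast at this
        refine (hle.trans this).trans (le_of_eq ?_)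
        rw [← hm']
        ring
    _ ≤ _ := by
        rw [Finset.sum_sub_distrib, Finset.sum_const, ← Finset.mul_sum, nsmul_eq_mul,
          card_piFinset_steps]
        have := mul_le_mul_of_nonneg_left (sum_numBacktracks_ge hd K)
          (show 0 ≤ 2 * g by linarith)
        refine (sub_le_sub_left this _).trans (le_of_eq ?_)
        ring

lemma exists_affine_bound {d : ℕ} {g γstar : ℝ} (hg : 0 ≤ g) (hlt : γstar < g)
    (h2 : Tendsto (fun n : ℕ => maxPathCap d n / n) atTop (nhds γstar)) :
    ∃ C : ℝ, ∀ m : ℕ, maxPathCap d m ≤ g * m + C := by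
  obtain ⟨M, hM⟩ := eventually_atTop.1 (h2.eventually (gt_mem_nhds hlt))
  refine ⟨M + 1, fun m => ?_⟩
  have hgm : 0 ≤ g * m := by positivity
  rcases le_or_gt m M with hm | hm
  · have : (m : ℝ) ≤ M := by exact_mod_cast hm
    linarith [maxPathCap_le d m]
  · have hm0 : (0 : ℝ) < m := by exact_mod_cast (by omega)
    have := (div_lt_iff₀ hm0).1 (hM m hm.le)
    have hM0 : (0 : ℝ) ≤ M := by positivity
    linarith

/-- For `d ≥ 5`, `γ_d < γ_d^*`: the a.s. growth rate of `Cap(R_n)` is strictly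
smaller than the limit of the maximal capacity `c_n/n` over nearest-neighbor paths. -/
theorem gamma_lt_gammaStar {d : ℕ} (hd : 5 ≤ d) (γ γstar : ℝ)
    (h1 : Tendsto (fun n : ℕ => expCapRange d n / n) atTop (nhds γ))
    (h2 : Tendsto (fun n : ℕ => maxPathCap d n / n) atTop (nhds γstar)) :
    γ < γstar := by
  have hd0 : (0 : ℝ) < d := by exact_mod_cast (by omega)
  have hstar : 0 < γstar := by
    refine lt_of_lt_of_le (show 0 < 4 / (3 * (d : ℝ)) by positivity) (ge_of_tendsto h2 ?_)
    filter_upwards [eventually_gt_atTop 0] with n hn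
    have hn0 : (0 : ℝ) < n := by exact_mod_cast hn
    rw [le_div_iff₀ hn0]
    refine le_trans ?_ (maxPathCap_ge hd n)
    gcongr
    linarith
  set p : ℝ := 1 / ((2 * d : ℕ) : ℝ) ^ 2 with hp
  have hp0 : 0 < p := by
    rw [hp]
    push_cast
    positivity
  set g : ℝ := γstar * (1 + p) with hg
  have hlt : γstar < g := by nlinarith
  obtain ⟨C, hC⟩ := exists_affine_bound (hstar.trans hlt).le hlt h2
  have hbound : γ ≤ g * (1 - p) := by
    have hsub : Tendsto (fun K : ℕ => 2 * (K + 1)) atTop atTop :=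
      tendsto_atTop_mono (fun K => by omega : ∀ K : ℕ, K ≤ 2 * (K + 1)) tendsto_id
    have hinv : Tendsto (fun K : ℕ => (1 : ℝ) / (K + 1)) atTop (nhds 0) :=
      tendsto_one_div_add_atTop_nhds_zero_nat
    have hrhs : Tendsto (fun K : ℕ => g * (1 - p) + (g * p + C / 2) * ((1 : ℝ) / (K + 1)))
        atTop (nhds (g * (1 - p))) := by
      simpa using (hinv.const_mul (g * p + C / 2)).const_add (g * (1 - p))
    refine le_of_tendsto_of_tendsto' (h1.comp hsub) hrhs fun K => ?_
    have hK : (0 : ℝ) < K + 1 := by positivity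
    have := expCapRange_le (by omega) (hstar.trans hlt).le hC K
    simp only [Function.comp_apply]
    push_cast at this ⊢
    rw [div_le_iff₀ (by positivity)]
    refine this.trans (le_of_eq ?_)
    rw [hp]
    push_cast
    field_simp
    ring
  nlinarith [mul_pos hstar (mul_pos hp0 hp0)]

end SRW
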